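/- arXiv:1903.03334 — 2 statements merged into one kernel-verified Lean document; each statement's English description precedes it below -/
import Mathlib

section
/- If K is a free factor of a group G and H is a subgroup of G, then H ∩ K is a free factor of H. -/
/-- A subgroup `H` of a group `G` is a *free factor* of `G` if there exists a subgroup
`K ≤ G` such that the natural map `H ∗ K → G` induced by the inclusions is an
isomorphism (written `G = H * K`). -/
def IsFreeFactor {G : Type*} [Group G] (H : Subgroup G) : Prop :=
  ∃ K : Subgroup G, Function.Bijective (Monoid.Coprod.lift H.subtype K.subtype)

open Monoid (Coprod)

/-- A map `c : G → X → B` is a cocycle on the subgroup `K` if it satisfies the cocycle identity for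
elements of `K`, i.e. it is a functor from the action groupoid of `K` on `X` to `B`. -/
def IsCocycleOn {G X B : Type*} [Group G] [MulAction G X] [Group B]
    (K : Subgroup G) (c : G → X → B) : Prop :=
  ∀ g ∈ K, ∀ h ∈ K, ∀ x, c (g * h) x = c g (h • x) * c h x

namespace IsCocycleOn

variable {G X B : Type*} [Group G] [MulAction G X] [Group B] {K : Subgroup G} {c : G → X → B}

theorem map_one (hc : IsCocycleOn K c) (x : X) : c 1 x = 1 := by
  have h := hc 1 K.one_mem 1 K.one_mem x
  rw [one_smul, mul_one] at h
  exact left_eq_mul.mp h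

theorem map_mul (hc : IsCocycleOn ⊤ c) (g h : G) (x : X) : c (g * h) x = c g (h • x) * c h x :=
  hc g trivial h trivial x

theorem map_inv (hc : IsCocycleOn ⊤ c) {g : G} {x y : X} (h : g • x = y) :
    c g⁻¹ y = (c g x)⁻¹ := by
  rw [eq_inv_iff_mul_eq_one, ← h, ← hc.map_mul, inv_mul_cancel, hc.map_one]

end IsCocycleOn

section FreeProduct

variable {G : Type*} [Group G] {K L : Subgroup G}

theorem induction_of_coprod_lift_surjective
    (hKL : Function.Surjective (Coprod.lift K.subtype L.subtype)) {p : G → Prop}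
    (left : ∀ k ∈ K, p k) (right : ∀ l ∈ L, p l) (mul : ∀ g h, p g → p h → p (g * h)) (g : G) :
    p g := by
  obtain ⟨w, rfl⟩ := hKL g
  induction w using Coprod.induction_on with
  | inl k => simpa using left k k.2
  | inr l => simpa using right l l.2
  | mul a b ha hb => rw [map_mul]; exact mul _ _ ha hb

variable {X B : Type*} [MulAction G X] [Group B]

theorem IsCocycleOn.congr_of_coprod_lift_surjective
    (hKL : Function.Surjective (Coprod.lift K.subtype L.subtype)) {c d : G → X → B}
    (hc : IsCocycleOn ⊤ c) (hd : IsCocycleOn ⊤ d) (left : ∀ k ∈ K, ∀ x, c k x = d k x)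
    (right : ∀ l ∈ L, ∀ x, c l x = d l x) (g : G) (x : X) : c g x = d g x := by
  revert x
  refine induction_of_coprod_lift_surjective hKL (p := fun g => ∀ x, c g x = d g x)
    left right (fun g h hg hh x => ?_) g
  rw [hc.map_mul, hd.map_mul, hg, hh]

/-- The action of `K` on `X × B` twisted by a cocycle. -/
def IsCocycleOn.toEnd {f : G → X → B} (hf : IsCocycleOn K f) : K →* Function.End (X × B) where
  toFun k p := ((k : G) • p.1, f k p.1 * p.2)
  map_one' := by
    funext p
    change (_, _) = p
    simp [hf.map_one]
  map_mul' k l := by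
    funext p
    change (_, _) = (_, _)
    simp [hf k k.2 l l.2, mul_smul, mul_assoc]

/-- Cocycles on the factors of a free product extend to a cocycle on the whole group. -/
theorem exists_isCocycleOn_top_of_coprod_lift_bijective
    (hKL : Function.Bijective (Coprod.lift K.subtype L.subtype)) {f g : G → X → B}
    (hf : IsCocycleOn K f) (hg : IsCocycleOn L g) :
    ∃ c : G → X → B, IsCocycleOn ⊤ c ∧ (∀ k ∈ K, ∀ x, c k x = f k x) ∧
      ∀ l ∈ L, ∀ x, c l x = g l x := by
  let e := MulEquiv.ofBijective _ hKL
  let ρ : G →* Function.End (X × B) := (Coprod.lift hf.toEnd hg.toEnd).comp e.symm.toMonoidHom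
  have hρK : ∀ k ∈ K, ∀ p, ρ k p = (k • p.1, f k p.1 * p.2) := by
    intro k hk p
    have : e.symm k = Coprod.inl ⟨k, hk⟩ := by simp [MulEquiv.symm_apply_eq, e]
    change Coprod.lift hf.toEnd hg.toEnd (e.symm k) p = _
    rw [this, Coprod.lift_apply_inl]
    rfl
  have hρL : ∀ l ∈ L, ∀ p, ρ l p = (l • p.1, g l p.1 * p.2) := by
    intro l hl p
    have : e.symm l = Coprod.inr ⟨l, hl⟩ := by simp [MulEquiv.symm_apply_eq, e]
    change Coprod.lift hf.toEnd hg.toEnd (e.symm l) p = _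
    rw [this, Coprod.lift_apply_inr]
    rfl
  have hmul : ∀ a b p, ρ (a * b) p = ρ a (ρ b p) := fun a b p => by rw [map_mul]; rfl
  have key : ∀ a x b, ρ a (x, b) = (a • x, (ρ a (x, 1)).2 * b) := by
    refine induction_of_coprod_lift_surjective hKL.2 ?_ ?_ ?_
    · intro k hk x b
      simp [hρK k hk]
    · intro l hl x b
      simp [hρL l hl]
    · intro a a' ha ha' x b
      rw [hmul, hmul, ha' x b, ha' x 1, ha, ha _ (_ * 1)]
      simp [mul_smul, mul_assoc]
  refine ⟨fun a x => (ρ a (x, 1)).2, ?_, ?_, ?_⟩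
  · intro a _ b _ x
    change (ρ (a * b) (x, 1)).2 = _
    rw [hmul, key b, key a]
    simp
  · intro k hk x
    simp [hρK k hk]
  · intro l hl x
    simp [hρL l hl]

end FreeProduct

/-- A homomorphism `i` on a subgroup `A` of a subgroup `H` extends to a map on all of `G` which is
multiplicative on `A`. -/
theorem exists_extend_of_subgroup {G B : Type*} [Group G] [Group B] (H : Subgroup G)
    (A : Subgroup H) (i : A →* B) :
    ∃ α : G → B, (∀ a : A, α (a : H) = i a) ∧
      ∀ a b : G, (∃ a' : A, ((a' : H) : G) = a) → (∃ b' : A, ((b' : H) : G) = b) →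
        α (a * b) = α a * α b := by
  have hinj : Function.Injective (fun a : A => ((a : H) : G)) :=
    Subtype.val_injective.comp Subtype.val_injective
  have hα : ∀ a : A, Function.extend (fun a : A => ((a : H) : G)) i 1 (a : H) = i a :=
    fun a => hinj.extend_apply _ _ a
  refine ⟨_, hα, ?_⟩
  rintro _ _ ⟨a, rfl⟩ ⟨b, rfl⟩
  rw [hα, hα, ← map_mul, ← hα]
  rfl

section Stabilizer

open MulAction

variable {G X : Type*} [Group G] [MulAction G X] {K L : Subgroup G}

theorem smul_mem_orbit_subgroup_iff (K : Subgroup G) (x₀ : X) (k : G) (hk : k ∈ K) (x : X) :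
    k • x ∈ orbit K x₀ ↔ x ∈ orbit K x₀ := by
  rw [← orbit_eq_iff, ← orbit_eq_iff (a := x)]
  exact (orbit_smul (⟨k, hk⟩ : K) x).congr_left

/-- A retraction of the action groupoid of `G = K * L` on `X` which collapses the vertex group
of `K` at `x₀`. -/
theorem exists_cocycle_retraction
    (hKL : Function.Bijective (Coprod.lift K.subtype L.subtype)) (x₀ : X) {s : X → G}
    (hs : ∀ x ∈ orbit K x₀, s x • x₀ = x) (hsK : ∀ x ∈ orbit K x₀, s x ∈ K) :
    ∃ R : G → X → G, IsCocycleOn ⊤ R ∧ (∀ g x, R g x • x = g • x) ∧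
      (∀ g x, R (R g x) x = R g x) ∧
      (∀ k ∈ K, ∀ x ∈ orbit K x₀, R k x = s (k • x) * (s x)⁻¹) ∧
      (∀ k ∈ K, ∀ x ∉ orbit K x₀, R k x = k) ∧ ∀ l ∈ L, ∀ x, R l x = l := by
  classical
  have horb := smul_mem_orbit_subgroup_iff K x₀
  obtain ⟨R, hR, hRK, hRL⟩ := exists_isCocycleOn_top_of_coprod_lift_bijective hKL
    (f := fun k x => if x ∈ orbit K x₀ then s (k • x) * (s x)⁻¹ else k) (g := fun l (_ : X) => l)
    (by
      intro k hk l hl x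
      by_cases hx : x ∈ orbit K x₀ <;> simp [horb l hl, hx, mul_smul])
    (fun _ _ _ _ _ => rfl)
  have hRin : ∀ k ∈ K, ∀ x ∈ orbit K x₀, R k x = s (k • x) * (s x)⁻¹ := fun k hk x hx => by
    rw [hRK k hk, if_pos hx]
  have hRout : ∀ k ∈ K, ∀ x ∉ orbit K x₀, R k x = k := fun k hk x hx => by
    rw [hRK k hk, if_neg hx]
  have hsmul : ∀ g x, R g x • x = g • x := by
    refine induction_of_coprod_lift_surjective hKL.2 ?_ ?_ ?_
    · intro k hk x
      by_cases hx : x ∈ orbit K x₀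
      · rw [hRin k hk x hx, mul_smul, inv_smul_eq_iff.mpr (hs x hx).symm,
          hs _ ((horb k hk x).2 hx)]
      · rw [hRout k hk x hx]
    · intro l hl x
      rw [hRL l hl]
    · intro a b ha hb x
      rw [hR.map_mul, mul_smul, hb, ha, mul_smul]
  refine ⟨R, hR, hsmul, ?_, hRin, hRout, hRL⟩
  refine IsCocycleOn.congr_of_coprod_lift_surjective hKL.2 (c := fun g x => R (R g x) x) ?_ hR ?_ ?_
  · intro a _ b _ x
    simp only [hR.map_mul, hsmul]
  · intro k hk x
    by_cases hx : x ∈ orbit K x₀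
    · have hk' : R k x ∈ K := by
        rw [hRin k hk x hx]
        exact K.mul_mem (hsK _ ((horb k hk x).2 hx)) (K.inv_mem (hsK x hx))
      change R (R k x) x = R k x
      rw [hRin _ hk' x hx, hsmul, hRin k hk x hx]
    · simp only [hRout k hk x hx]
  · intro l hl x
    simp only [hRL l hl]

theorem exists_orbit_section (K : Subgroup G) (x₀ : X) :
    ∃ s : X → G, s x₀ = 1 ∧ (∀ x ∈ orbit K x₀, s x • x₀ = x) ∧ ∀ x ∈ orbit K x₀, s x ∈ K := by
  classical
  have h : ∀ x, ∃ g : G, (x = x₀ → g = 1) ∧ (x ∈ orbit K x₀ → g • x₀ = x ∧ g ∈ K) := by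
    intro x
    by_cases hx : x = x₀
    · exact ⟨1, fun _ => rfl, fun _ => ⟨by simp [hx], K.one_mem⟩⟩
    · by_cases hx' : x ∈ orbit K x₀
      · obtain ⟨k, hk⟩ := hx'
        exact ⟨k, fun h => absurd h hx, fun _ => ⟨hk, k.2⟩⟩
      · exact ⟨1, fun h => absurd h hx, fun h => absurd h hx'⟩
  choose s hs using h
  exact ⟨s, (hs x₀).1 rfl, fun x hx => ((hs x).2 hx).1, fun x hx => ((hs x).2 hx).2⟩

theorem isFreeFactor_inf_stabilizer_subgroupOf [IsPretransitive G X]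
    (hK : IsFreeFactor K) (x₀ : X) :
    IsFreeFactor ((stabilizer G x₀ ⊓ K).subgroupOf (stabilizer G x₀)) := by
  classical
  obtain ⟨L, hKL⟩ := hK
  obtain ⟨s, hs₀, hs, hsK⟩ := exists_orbit_section K x₀
  obtain ⟨R, hR, hsmul, hRR, hRin, hRout, hRL⟩ := exists_cocycle_retraction hKL x₀ hs hsK
  have horb := smul_mem_orbit_subgroup_iff K x₀
  have hx₀ : x₀ ∈ orbit K x₀ := mem_orbit_self x₀
  -- a transversal lying in the image of the retraction and extending `s`
  obtain ⟨t, ht, htR, hts⟩ : ∃ t : X → G, (∀ x, t x • x₀ = x) ∧ (∀ x, R (t x) x₀ = t x) ∧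
      ∀ x ∈ orbit K x₀, t x = s x := by
    choose u hu using fun x => exists_smul_eq G x₀ x
    refine ⟨fun x => if x ∈ orbit K x₀ then s x else R (u x) x₀, fun x => ?_, fun x => ?_,
      fun x hx => if_pos hx⟩
    · by_cases hx : x ∈ orbit K x₀
      · simp only [if_pos hx, hs x hx]
      · simp only [if_neg hx, hsmul, hu]
    · by_cases hx : x ∈ orbit K x₀
      · simp only [if_pos hx]
        rw [hRin _ (hsK x hx) _ hx₀, hs x hx, hs₀, inv_one, mul_one]
      · simp only [if_neg hx, hRR]
  have ht₀ : t x₀ = 1 := by rw [hts x₀ hx₀, hs₀]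
  have ht' : ∀ x, (t x)⁻¹ • x = x₀ := fun x => inv_smul_eq_iff.mpr (ht x).symm
  have hstab : ∀ g x, ((t (g • x))⁻¹ * g * t x) • x₀ = x₀ := fun g x => by
    rw [mul_smul, mul_smul, ht, ht']
  let H := stabilizer G x₀
  let A : Subgroup H := (H ⊓ K).subgroupOf H
  let M : Subgroup H :=
    { carrier := {h | R h x₀ = h}
      one_mem' := hR.map_one x₀
      mul_mem' := fun {a b} ha hb => by
        have hb' : (b : G) • x₀ = x₀ := b.2
        change R (a * b) x₀ = a * b
        rw [hR.map_mul, hb', ha, hb]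
      inv_mem' := fun {a} ha => by
        change R (a : G)⁻¹ x₀ = (a : G)⁻¹
        rw [hR.map_inv a.2, ha] }
  have hA : ∀ g, g • x₀ = x₀ → g ∈ K → ∃ a : A, ((a : H) : G) = g := fun g h hk =>
    ⟨⟨⟨g, h⟩, h, hk⟩, rfl⟩
  have hM : ∀ g, g • x₀ = x₀ → R g x₀ = g → ∃ m : M, ((m : H) : G) = g := fun g h hr =>
    ⟨⟨⟨g, h⟩, hr⟩, rfl⟩
  obtain ⟨α, hα, hαmul⟩ := exists_extend_of_subgroup H A (Coprod.inl : A →* Coprod A M)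
  obtain ⟨β, hβ, hβmul⟩ := exists_extend_of_subgroup H M (Coprod.inr : M →* Coprod A M)
  have hsplit : ∀ g h x, (t ((g * h) • x))⁻¹ * (g * h) * t x =
      ((t (g • h • x))⁻¹ * g * t (h • x)) * ((t (h • x))⁻¹ * h * t x) := fun g h x => by
    rw [mul_smul]; group
  have hMt : ∀ g x, R g x = g → ∃ m : M, ((m : H) : G) = (t (g • x))⁻¹ * g * t x := by
    intro g x hg
    refine hM _ (hstab g x) ?_
    rw [hR.map_mul, hR.map_mul, ht, hR.map_inv (ht (g • x)), htR, htR, hg]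
  have hAt : ∀ k ∈ K, ∀ x ∈ orbit K x₀, ∃ a : A, ((a : H) : G) = (t (k • x))⁻¹ * k * t x := by
    intro k hk x hx
    refine hA _ (hstab k x) ?_
    rw [hts x hx, hts _ ((horb k hk x).2 hx)]
    exact K.mul_mem (K.mul_mem (K.inv_mem (hsK _ ((horb k hk x).2 hx))) hk) (hsK x hx)
  obtain ⟨c, hc, hcK, hcL⟩ := exists_isCocycleOn_top_of_coprod_lift_bijective hKL
    (f := fun k x => if x ∈ orbit K x₀ then α ((t (k • x))⁻¹ * k * t x)
      else β ((t (k • x))⁻¹ * k * t x))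
    (g := fun l x => β ((t (l • x))⁻¹ * l * t x))
    (by
      intro k hk l hl x
      by_cases hx : x ∈ orbit K x₀
      · have hlx := (horb l hl x).2 hx
        simp only [if_pos hx, if_pos hlx]
        rw [hsplit, hαmul _ _ (hAt k hk _ hlx) (hAt l hl _ hx)]
      · have hlx := mt (horb l hl x).1 hx
        simp only [if_neg hx, if_neg hlx]
        rw [hsplit, hβmul _ _ (hMt k _ (hRout k hk _ hlx)) (hMt l _ (hRout l hl _ hx))])
    (by
      intro k hk l hl x
      simp only
      rw [hsplit, hβmul _ _ (hMt k _ (hRL k hk _)) (hMt l _ (hRL l hl _))])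
  let ψ : Coprod A M →* H := Coprod.lift A.subtype M.subtype
  have hψα : ∀ g, (∃ a : A, ((a : H) : G) = g) → (ψ (α g) : G) = g := by
    rintro _ ⟨a, rfl⟩
    rw [hα, Coprod.lift_apply_inl]
    rfl
  have hψβ : ∀ g, (∃ m : M, ((m : H) : G) = g) → (ψ (β g) : G) = g := by
    rintro _ ⟨m, rfl⟩
    rw [hβ, Coprod.lift_apply_inr]
    rfl
  have hψc : ∀ g x, (ψ (c g x) : G) = (t (g • x))⁻¹ * g * t x := by
    refine IsCocycleOn.congr_of_coprod_lift_surjective hKL.2 (c := fun g x => (ψ (c g x) : G))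
      (d := fun g x => (t (g • x))⁻¹ * g * t x) ?_ ?_ ?_ ?_
    · intro a _ b _ x
      simp only [hc.map_mul, map_mul, Subgroup.coe_mul]
    · intro a _ b _ x
      exact hsplit a b x
    · intro k hk x
      simp only [hcK k hk]
      by_cases hx : x ∈ orbit K x₀
      · rw [if_pos hx, hψα _ (hAt k hk x hx)]
      · rw [if_neg hx, hψβ _ (hMt k x (hRout k hk x hx))]
    · intro l hl x
      simp only [hcL l hl]
      exact hψβ _ (hMt l x (hRL l hl x))
  have hcR : ∀ g x, c (R g x) x = β ((t (g • x))⁻¹ * R g x * t x) := by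
    have hMR : ∀ g x, ∃ m : M, ((m : H) : G) = (t (g • x))⁻¹ * R g x * t x := fun g x => by
      simpa only [hsmul] using hMt (R g x) x (hRR g x)
    refine IsCocycleOn.congr_of_coprod_lift_surjective hKL.2 (c := fun g x => c (R g x) x)
      (d := fun g x => β ((t (g • x))⁻¹ * R g x * t x)) ?_ ?_ ?_ ?_
    · intro a _ b _ x
      simp only [hR.map_mul, hc.map_mul, hsmul]
    · intro a _ b _ x
      simp only
      rw [← hβmul _ _ (hMR a _) (hMR b _), hR.map_mul, mul_smul]
      congr 1
      group
    · intro k hk x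
      by_cases hx : x ∈ orbit K x₀
      · have hkx := (horb k hk x).2 hx
        have hk' : R k x ∈ K := by
          rw [hRin k hk x hx]
          exact K.mul_mem (hsK _ hkx) (K.inv_mem (hsK x hx))
        have h1 : (t (k • x))⁻¹ * R k x * t x = 1 := by
          rw [hRin k hk x hx, hts x hx, hts _ hkx]
          group
        have hα1 : α 1 = 1 := by simpa using hα 1
        have hβ1 : β 1 = 1 := by simpa using hβ 1
        simp only [hcK _ hk', if_pos hx, hsmul, h1, hα1, hβ1]
      · simp only [hRout k hk x hx, hcK k hk, if_neg hx]
    · intro l hl x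
      simp only [hRL l hl, hcL l hl]
  let φ : H →* Coprod A M :=
    { toFun := fun h => c h x₀
      map_one' := hc.map_one x₀
      map_mul' := fun a b => by
        have hb : (b : G) • x₀ = x₀ := b.2
        rw [Subgroup.coe_mul, hc.map_mul, hb] }
  have hφψ : φ.comp ψ = MonoidHom.id _ := by
    refine Coprod.hom_ext ?_ ?_ <;> ext a
    · have ha : ((a : H) : G) • x₀ = x₀ := (a : H).2
      have hk : ((a : H) : G) ∈ K := a.2.2
      change c ((ψ (Coprod.inl a) : H) : G) x₀ = Coprod.inl a
      rw [Coprod.lift_apply_inl, ← hα]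
      change c ((a : H) : G) x₀ = _
      rw [hcK _ hk, if_pos hx₀, ha, ht₀]
      simp
    · have ha : ((a : H) : G) • x₀ = x₀ := (a : H).2
      have hr : R ((a : H) : G) x₀ = ((a : H) : G) := a.2
      change c ((ψ (Coprod.inr a) : H) : G) x₀ = Coprod.inr a
      rw [Coprod.lift_apply_inr, ← hβ]
      change c ((a : H) : G) x₀ = _
      have h := hcR ((a : H) : G) x₀
      rw [hr, ha, ht₀] at h
      simpa using h
  refine ⟨M, Function.LeftInverse.injective (g := φ) fun w => DFunLike.congr_fun hφψ w,
    fun h => ⟨φ h, ?_⟩⟩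
  change ψ (c h x₀) = h
  have hh : (h : G) • x₀ = x₀ := h.2
  have := hψc h x₀
  rw [hh, ht₀] at this
  simpa using this

end Stabilizer

/-- If `K` is a free factor of a group `G` and `H` is a subgroup of `G`, then `H ∩ K`
is a free factor of `H`. -/
theorem isFreeFactor_inf_subgroupOf_of_isFreeFactor {G : Type*} [Group G]
    (K H : Subgroup G) (hK : IsFreeFactor K) :
    IsFreeFactor ((H ⊓ K).subgroupOf H) := by
  have h := isFreeFactor_inf_stabilizer_subgroupOf hK ((1 : G) : G ⧸ H)
  rwa [MulAction.stabilizer_quotient] at h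
end

section
/- Let L_0 and L_1 be groups and let L_0 * L_1 denote their free product. If ψ : F_a → L_0 * L_1 is an injective homomorphism such that ψ(F_1) = ψ(F_a) ∩ L_0 and ψ(F_0 ∨ F_{2,a}) = ψ(F_a) ∩ L_1 (where L_0 and L_1 are identified with their canonical images in L_0 * L_1), then there does not exist an injective homomorphism θ : F_b → L_0 * L_1 with θ ∘ φ = ψ. -/
/-- The generating alphabet `X ⊔ Y ⊔ {y} ⊔ {indexed family over ℕ}`.  In the domain
`F_a` the `ℕ`-indexed generators are the `t_n`; in the codomain `F_b` they are the
`z_n`. -/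
abbrev ConstrGen (X Y : Type) : Type := X ⊕ Y ⊕ Unit ⊕ ℕ

/-- The distinguished generator `y`. -/
def yGen (X Y : Type) : ConstrGen X Y := Sum.inr (Sum.inr (Sum.inl ()))

/-- The `n`-th `ℕ`-indexed generator (`t_n` in `F_a`, `z_n` in `F_b`). -/
def nGen (X Y : Type) (n : ℕ) : ConstrGen X Y := Sum.inr (Sum.inr (Sum.inr n))

/-- The homomorphism `φ : F_a → F_b` which fixes each generator in `X ⊔ Y ⊔ {y}`
and sends `t_n ↦ y·z_{n+1}⁻¹·z_n·z_{n+1}`. -/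
def constrPhi (X Y : Type) : FreeGroup (ConstrGen X Y) →* FreeGroup (ConstrGen X Y) :=
  FreeGroup.lift fun g => match g with
    | Sum.inl x => FreeGroup.of (Sum.inl x)
    | Sum.inr (Sum.inl w) => FreeGroup.of (Sum.inr (Sum.inl w))
    | Sum.inr (Sum.inr (Sum.inl _)) => FreeGroup.of (yGen X Y)
    | Sum.inr (Sum.inr (Sum.inr n)) =>
        FreeGroup.of (yGen X Y) * (FreeGroup.of (nGen X Y (n + 1)))⁻¹ *
          FreeGroup.of (nGen X Y n) * FreeGroup.of (nGen X Y (n + 1))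


/-- The subgroup `F_1 = ⟨Y ∪ {y}⟩` of `F_a`. -/
def F1sub (X Y : Type) : Subgroup (FreeGroup (ConstrGen X Y)) :=
  Subgroup.closure (FreeGroup.of '' {g : ConstrGen X Y | match g with
    | Sum.inr (Sum.inl _) => True
    | Sum.inr (Sum.inr (Sum.inl _)) => True
    | _ => False})

/-- The subgroup `F_0 ∨ F_{2,a} = ⟨X ∪ {t_n : n ∈ ℕ}⟩` of `F_a`. -/
def F02sub (X Y : Type) : Subgroup (FreeGroup (ConstrGen X Y)) :=
  Subgroup.closure (FreeGroup.of '' {g : ConstrGen X Y | match g with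
    | Sum.inl _ => True
    | Sum.inr (Sum.inr (Sum.inr _)) => True
    | _ => False})

namespace Monoid.CoprodI

/-- The list alternating between two elements, with `n` repetitions. -/
def altList {α : Type*} (s t : α) (n : ℕ) : List α := (List.replicate n [s, t]).flatten

theorem altList_succ {α : Type*} (s t : α) (n : ℕ) :
    altList s t (n + 1) = s :: t :: altList s t n := by
  simp [altList, List.replicate_succ]

theorem suffix_altList {α : Type*} {s t : α} {n : ℕ} {l : List α} (h : l <:+ altList s t n) :
    l = [] ∨ (∃ k, l = altList s t (k + 1)) ∨ ∃ k, l = t :: altList s t k := by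
  induction n with
  | zero => left; simpa [altList] using h
  | succ n ih =>
    rw [altList_succ, List.suffix_cons_iff, List.suffix_cons_iff] at h
    rcases h with h | h | h
    · exact .inr (.inl ⟨n, by rw [h, altList_succ]⟩)
    · exact .inr (.inr ⟨n, h⟩)
    · exact ih h

section Group

variable {ι : Type*} {M : ι → Type*} [∀ i, Group (M i)]

/-- The element of the free product spelled by a (not necessarily reduced) list of letters. -/
def listProd (l : List (Σ i, M i)) : CoprodI M := (l.map fun s => of s.2).prod

@[simp] theorem listProd_nil : listProd ([] : List (Σ i, M i)) = 1 := rfl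

@[simp] theorem listProd_cons (s : Σ i, M i) (l : List (Σ i, M i)) :
    listProd (s :: l) = of s.2 * listProd l := by simp [listProd]

@[simp] theorem listProd_append (l m : List (Σ i, M i)) :
    listProd (l ++ m) = listProd l * listProd m := by simp [listProd]

/-- The formal inverse of a list of letters. -/
def listInv (l : List (Σ i, M i)) : List (Σ i, M i) := (l.map fun s => ⟨s.1, s.2⁻¹⟩).reverse

@[simp] theorem listProd_listInv (l : List (Σ i, M i)) : listProd (listInv l) = (listProd l)⁻¹ := by
  induction l with
  | nil => simp [listInv]
  | cons s l ih =>
    have : listInv (s :: l) = listInv l ++ [⟨s.1, s.2⁻¹⟩] := by simp [listInv]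
    simp [this, ih]

/-- A list of letters is reduced if no letter is trivial and neighbours come from different
factors. -/
def Reduced (l : List (Σ i, M i)) : Prop :=
  (∀ s ∈ l, s.2 ≠ 1) ∧ l.IsChain fun s t => s.1 ≠ t.1

theorem reduced_nil : Reduced ([] : List (Σ i, M i)) := ⟨by simp, by simp⟩

theorem reduced_cons {s : Σ i, M i} {l : List (Σ i, M i)} :
    Reduced (s :: l) ↔ s.2 ≠ 1 ∧ (∀ t ∈ l.head?, s.1 ≠ t.1) ∧ Reduced l := by
  simp only [Reduced, List.forall_mem_cons, List.isChain_cons]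
  tauto

theorem Reduced.conj {l : List (Σ i, M i)} {i j : ι} {a x z : M i} {y : M j} (hij : i ≠ j)
    (h : Reduced (l ++ [⟨i, a⟩])) (hx : x ≠ 1) (hy : y ≠ 1) (hz : z ≠ 1) :
    Reduced (l ++ ⟨i, x⟩ :: ⟨j, y⟩ :: ⟨i, z⟩ :: listInv l) := by
  obtain ⟨h₁, h₂⟩ := h
  rw [List.isChain_append] at h₂
  obtain ⟨hl, -, hla⟩ := h₂
  refine ⟨?_, ?_⟩
  · intro s hs
    simp only [listInv, List.mem_append, List.mem_cons, List.mem_reverse, List.mem_map] at hs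
    rcases hs with hs | rfl | rfl | rfl | ⟨t, ht, rfl⟩
    · exact h₁ s (by simp [hs])
    · exact hx
    · exact hy
    · exact hz
    · simpa using h₁ t (by simp [ht])
  · rw [List.isChain_append]
    refine ⟨hl, ?_, by simpa using hla⟩
    rw [List.isChain_cons_cons, List.isChain_cons_cons, List.isChain_cons]
    refine ⟨hij, hij.symm, ?_, ?_⟩
    · intro t ht
      simp only [listInv, List.head?_reverse, List.getLast?_map, Option.mem_def,
        Option.map_eq_some_iff] at ht
      obtain ⟨r, hr, rfl⟩ := ht
      exact (hla r hr ⟨i, a⟩ (by simp)).symm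
    · rw [listInv, List.isChain_reverse, List.isChain_map]
      exact hl.imp fun _ _ h => h.symm

theorem listProd_altList (s t : Σ i, M i) (n : ℕ) :
    listProd (altList s t n) = (of s.2 * of t.2) ^ n := by
  induction n with
  | zero => simp [altList]
  | succ n ih => simp [altList_succ, ih, pow_succ', mul_assoc]

theorem reduced_altList {s t : Σ i, M i} (hs : s.2 ≠ 1) (ht : t.2 ≠ 1) (hst : s.1 ≠ t.1) (n : ℕ) :
    Reduced (altList s t n) := by
  induction n with
  | zero => exact reduced_nil
  | succ n ih =>
    rw [altList_succ, reduced_cons, reduced_cons]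
    refine ⟨hs, by simpa using hst, ht, ?_, ih⟩
    cases n with
    | zero => simp [altList]
    | succ n => simpa [altList_succ] using hst.symm

variable [DecidableEq ι] [∀ i, DecidableEq (M i)]

/-- The normal form of an element of a free product, as a list of letters. -/
def normalForm (x : CoprodI M) : List (Σ i, M i) := (Word.equiv x).toList

theorem reduced_normalForm (x : CoprodI M) : Reduced (normalForm x) :=
  ⟨(Word.equiv x).ne_one, (Word.equiv x).chain_ne⟩

@[simp] theorem listProd_normalForm (x : CoprodI M) : listProd (normalForm x) = x :=
  Word.equiv.symm_apply_apply x

theorem Reduced.normalForm_eq {l : List (Σ i, M i)} (h : Reduced l) {x : CoprodI M}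
    (hx : listProd l = x) : normalForm x = l := by
  subst hx
  exact congrArg Word.toList (Word.equiv.apply_symm_apply ⟨l, h.1, h.2⟩)

theorem drop_one_normalForm_of_mul (s : Σ i, M i) (x : CoprodI M) :
    (normalForm (of s.2 * x)).drop 1 <:+ normalForm x := by
  obtain ⟨i, g⟩ := s
  have hr := reduced_normalForm x
  have hx := listProd_normalForm x
  by_cases hg : g = 1
  · subst hg
    simpa using List.drop_suffix 1 (normalForm x)
  by_cases hi : ∀ t ∈ (normalForm x).head?, i ≠ t.1
  · rw [(reduced_cons (s := ⟨i, g⟩).2 ⟨hg, hi, hr⟩).normalForm_eq (x := of g * x) (by simp)]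
    simp
  · push Not at hi
    obtain ⟨⟨j, h⟩, ht, rfl⟩ := hi
    obtain ⟨l, hl⟩ : ∃ l, normalForm x = ⟨i, h⟩ :: l := by
      cases hn : normalForm x with
      | nil => simp [hn] at ht
      | cons a l =>
        simp only [hn, List.head?_cons, Option.mem_def, Option.some.injEq] at ht
        exact ⟨l, by rw [ht]⟩
    rw [hl] at hr hx ⊢
    rw [reduced_cons] at hr
    by_cases hgh : g * h = 1
    · rw [hr.2.2.normalForm_eq (x := of g * x)
        (by rw [← hx, listProd_cons, ← mul_assoc, ← map_mul, hgh, map_one, one_mul])]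
      exact (List.drop_suffix 1 l).trans (List.suffix_cons _ _)
    · rw [(reduced_cons (s := ⟨i, g * h⟩).2 ⟨hgh, hr.2⟩).normalForm_eq (x := of g * x)
        (by rw [← hx, listProd_cons, listProd_cons, map_mul, mul_assoc])]
      exact List.suffix_cons _ _

theorem drop_normalForm_listProd_mul (l : List (Σ i, M i)) (x : CoprodI M) :
    (normalForm (listProd l * x)).drop l.length <:+ normalForm x := by
  induction l with
  | nil => simp
  | cons s l ih =>
    have h := drop_one_normalForm_of_mul s (listProd l * x)
    rw [listProd_cons, mul_assoc, List.length_cons, add_comm, ← List.drop_drop]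
    obtain ⟨k, hk⟩ : ∃ k, (normalForm (of s.2 * (listProd l * x))).drop 1 =
        (normalForm (listProd l * x)).drop k := ⟨_, List.suffix_iff_eq_drop.1 h⟩
    rw [hk, List.drop_drop, add_comm, ← List.drop_drop]
    exact (List.drop_suffix _ _).trans ih

theorem length_normalForm_listProd_le (l : List (Σ i, M i)) :
    (normalForm (listProd l)).length ≤ l.length := by
  have h := drop_normalForm_listProd_mul l (1 : CoprodI M)
  rw [reduced_nil.normalForm_eq listProd_nil, List.suffix_nil, mul_one] at h
  exact List.drop_eq_nil_iff.1 h

end Group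

section Bool

variable {M : Bool → Type*} [∀ i, Group (M i)] [∀ i, DecidableEq (M i)]

theorem normalForm_zpow_suffix {b : M false} {c : M true} (hb : b ≠ 1) (hc : c ≠ 1) (k : ℤ)
    {l : List (Σ i, M i)} (h : l <:+ normalForm ((of b⁻¹ * of c : CoprodI M) ^ k)) :
    (∀ x m, l = ⟨true, x⟩ :: m → x = c ∨ x = c⁻¹) ∧
      ∀ x m, l = ⟨false, x⟩ :: m →
        x = b ∨ m ≠ [] ∧ ∃ j : ℤ, listProd l = (of b⁻¹ * of c) ^ j := by
  obtain ⟨n, rfl | rfl⟩ := k.eq_nat_or_neg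
  · rw [zpow_natCast, (reduced_altList (s := ⟨false, b⁻¹⟩) (t := ⟨true, c⟩) (by simpa) hc
      (by simp) n).normalForm_eq (listProd_altList ..)] at h
    rcases suffix_altList h with rfl | ⟨k, rfl⟩ | ⟨k, rfl⟩
    · simp
    · refine ⟨by simp [altList_succ], fun x m hm => .inr ⟨?_, (k + 1 : ℕ), ?_⟩⟩
      · rw [altList_succ] at hm
        simp only [List.cons.injEq] at hm
        simp [← hm.2]
      · rw [listProd_altList, zpow_natCast]
    · refine ⟨fun x m hm => .inl ?_, by simp⟩
      simp only [List.cons.injEq, Sigma.mk.injEq, heq_eq_eq, true_and] at hm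
      exact hm.1.symm
  · have e : ((of b⁻¹ * of c : CoprodI M) ^ (-(n : ℤ))) = (of c⁻¹ * of b) ^ n := by
      rw [zpow_neg, zpow_natCast, ← inv_pow]; simp
    rw [e, (reduced_altList (s := ⟨true, c⁻¹⟩) (t := ⟨false, b⟩) (by simpa) hb
      (by simp) n).normalForm_eq (listProd_altList ..)] at h
    rcases suffix_altList h with rfl | ⟨k, rfl⟩ | ⟨k, rfl⟩
    · simp
    · refine ⟨fun x m hm => .inr ?_, by simp [altList_succ]⟩
      simp only [altList_succ, List.cons.injEq, Sigma.mk.injEq, heq_eq_eq, true_and] at hm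
      exact hm.1.symm
    · refine ⟨by simp, fun x m hm => .inl ?_⟩
      simp only [List.cons.injEq, Sigma.mk.injEq, heq_eq_eq, true_and] at hm
      exact hm.1.symm

/-- If `p` is shortest in its coset of `⟨b⁻¹c'⟩` and the conjugate of `b⁻¹c'` by `p` lies in
`q⟨b⁻¹c⟩` with `q` not longer than `p`, then this conjugate is a conjugate by a power of `b⁻¹c`. -/
theorem exists_zpow_conj_of_length_le {b : M false} {c c' : M true} (hb : b ≠ 1) (hb' : b⁻¹ ≠ b)
    (hc : c ≠ 1) (hc' : c' ≠ 1) (h₁ : c' ≠ c) (h₂ : c' ≠ c⁻¹) {p q : CoprodI M} {k : ℤ}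
    (hmin : ∀ m : ℤ, (normalForm p).length ≤ (normalForm (p * (of b⁻¹ * of c') ^ m)).length)
    (hq : p * (of b⁻¹ * of c') * p⁻¹ = q * (of b⁻¹ * of c) ^ k)
    (hle : (normalForm q).length ≤ (normalForm p).length) :
    ∃ j : ℤ, p * (of b⁻¹ * of c') * p⁻¹ =
      ((of b⁻¹ * of c) ^ j)⁻¹ * (of b⁻¹ * of c') * (of b⁻¹ * of c) ^ j := by
  have hS : (normalForm (p * (of b⁻¹ * of c') * p⁻¹)).drop (normalForm p).length <:+
      normalForm ((of b⁻¹ * of c : CoprodI M) ^ k) := by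
    have h := drop_normalForm_listProd_mul (normalForm q) ((of b⁻¹ * of c : CoprodI M) ^ k)
    rw [listProd_normalForm, ← hq] at h
    refine .trans ?_ h
    rw [← Nat.sub_add_cancel hle, add_comm, ← List.drop_drop]
    exact List.drop_suffix _ _
  have hshort : Reduced [(⟨true, c'⟩ : Σ i, M i), ⟨false, b⁻¹⟩] := by
    simp [reduced_cons, reduced_nil, hc', hb]
  have hr := reduced_normalForm p
  have hp := listProd_normalForm p
  rcases List.eq_nil_or_concat (normalForm p) with hn | ⟨l, ⟨i, a⟩, hn⟩
  · rw [hn, listProd_nil] at hp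
    exact ⟨0, by simp [← hp]⟩
  have hmin₁ := hmin 1
  have hmin₂ := hmin (-1)
  rw [List.concat_eq_append] at hn
  rw [hn] at hr hp hS hmin₁ hmin₂
  have ha : a ≠ 1 := hr.1 ⟨i, a⟩ (by simp)
  simp only [listProd_append, listProd_cons, listProd_nil, mul_one] at hp
  cases i with
  | false =>
    by_cases hab : a = b
    · subst hab
      rcases List.eq_nil_or_concat l with rfl | ⟨l, ⟨j, d⟩, rfl⟩
      · rw [hshort.normalForm_eq (by simp [← hp])] at hS
        have := (normalForm_zpow_suffix hb hc k hS).2 a⁻¹ [] (by simp)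
        simp [hb'] at this
      · cases j with
        | false => simpa [List.isChain_append] using hr.2
        | true =>
          have h := length_normalForm_listProd_le (l ++ [(⟨true, d * c'⟩ : Σ i, M i)])
          have e : p * (of a⁻¹ * of c') ^ (1 : ℤ) =
              listProd (l ++ [(⟨true, d * c'⟩ : Σ i, M i)]) := by
            simp [← hp, mul_assoc]
          rw [e] at hmin₁
          simp at hmin₁ h
          lia
    · have hred := hr.conj (j := true) (x := a * b⁻¹) (y := c') (z := a⁻¹) (by simp)
        (by simpa [mul_inv_eq_one] using hab) hc' (by simpa)
      rw [hred.normalForm_eq (by simp [← hp, mul_assoc])] at hS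
      have := (normalForm_zpow_suffix hb hc k hS).1 c' _ (by simp; rfl)
      tauto
  | true =>
    by_cases hac : a = c'
    · subst hac
      rcases List.eq_nil_or_concat l with rfl | ⟨l, ⟨j, d⟩, rfl⟩
      · rw [hshort.normalForm_eq (by simp [← hp, mul_assoc])] at hS
        have := (normalForm_zpow_suffix hb hc k hS).2 b⁻¹ [] (by simp)
        simp [hb'] at this
      · cases j with
        | true => simpa [List.isChain_append] using hr.2
        | false =>
          have h := length_normalForm_listProd_le (l ++ [(⟨false, d * b⟩ : Σ i, M i)])
          have e : p * (of b⁻¹ * of a) ^ (-1 : ℤ) =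
              listProd (l ++ [(⟨false, d * b⟩ : Σ i, M i)]) := by
            simp [← hp, mul_assoc]
          rw [e] at hmin₂
          simp at hmin₂ h
          lia
    · have hred := hr.conj (j := false) (x := a) (y := b⁻¹) (z := c' * a⁻¹) (by simp)
        ha (by simpa) (by simpa [mul_inv_eq_one, eq_comm] using hac)
      rw [hred.normalForm_eq (by simp [← hp, mul_assoc])] at hS
      have := (normalForm_zpow_suffix hb hc k hS).2 b⁻¹ _ (by simp; rfl)
      obtain ⟨-, j, hj⟩ := this.resolve_left hb'
      have hj' : of b⁻¹ * of c' * p⁻¹ = (of b⁻¹ * of c) ^ j := by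
        rw [← hj, ← hp]; simp [mul_assoc]
      refine ⟨j, ?_⟩
      rw [← hj']
      group

/-- There is no infinite chain of conjugates `wₙ = wₙ₊₁ (b⁻¹cₙ) wₙ₊₁⁻¹` in a free product, apart
from degenerate ones. -/
theorem exists_zpow_conj_of_chain {b : M false} {c : ℕ → M true} (hb : b ≠ 1) (hb' : b⁻¹ ≠ b)
    (hc : ∀ n, c n ≠ 1) (h₁ : ∀ n, c (n + 1) ≠ c n) (h₂ : ∀ n, c (n + 1) ≠ (c n)⁻¹)
    (w : ℕ → CoprodI M) (hw : ∀ n, w n = w (n + 1) * (of b⁻¹ * of (c n)) * (w (n + 1))⁻¹) :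
    ∃ (n : ℕ) (j : ℤ), w (n + 1) = ((of b⁻¹ * of (c n)) ^ j)⁻¹ * (of b⁻¹ * of (c (n + 1))) *
      (of b⁻¹ * of (c n)) ^ j := by
  by_contra! H
  have hmin (n : ℕ) : ∃ k : ℤ, ∀ m : ℤ,
      (normalForm (w (n + 1) * (of b⁻¹ * of (c n)) ^ k)).length ≤
        (normalForm (w (n + 1) * (of b⁻¹ * of (c n)) ^ m)).length :=
    ⟨_, fun m => Function.argmin_le
      (fun m : ℤ => (normalForm (w (n + 1) * (of b⁻¹ * of (c n)) ^ m)).length) m⟩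
  choose k hk using hmin
  set p : ℕ → CoprodI M := fun n => w (n + 1) * (of b⁻¹ * of (c n)) ^ k n with hp
  have hpw (n : ℕ) : p n * (of b⁻¹ * of (c n)) * (p n)⁻¹ = w n := by
    rw [hw n]
    simp only [hp]
    generalize (of b⁻¹ * of (c n) : CoprodI M) = u
    group
  have hlt (n : ℕ) : (normalForm (p (n + 1))).length < (normalForm (p n)).length := by
    by_contra! hle
    obtain ⟨j, hj⟩ := exists_zpow_conj_of_length_le hb hb' (hc n) (hc (n + 1)) (h₁ n) (h₂ n)
      (p := p (n + 1)) (q := p n) (k := -k n)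
      (fun m => by
        have := hk (n + 1) (k (n + 1) + m)
        rwa [zpow_add, ← mul_assoc] at this)
      (by rw [hpw, hp]; group) hle
    exact H n j (by rw [← hj, hpw])
  exact (RelEmbedding.natGT _ hlt).not_wellFounded (r := (· < ·)) wellFounded_lt

end Bool

end Monoid.CoprodI

/-- Two groups as a family indexed by `Bool`. -/
def BoolFamily (G H : Type) : Bool → Type
  | false => G
  | true => H

instance (G H : Type) [Group G] [Group H] : ∀ i, Group (BoolFamily G H i)
  | false => inferInstanceAs (Group G)
  | true => inferInstanceAs (Group H)

/-- The canonical map from the binary to the indexed free product. -/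
def coprodToCoprodI (G H : Type) [Group G] [Group H] :
    Monoid.Coprod G H →* Monoid.CoprodI (BoolFamily G H) :=
  Monoid.Coprod.lift (Monoid.CoprodI.of (M := BoolFamily G H) (i := false))
    (Monoid.CoprodI.of (M := BoolFamily G H) (i := true))

theorem coprodToCoprodI_injective (G H : Type) [Group G] [Group H] :
    Function.Injective (coprodToCoprodI G H) := by
  let f : ∀ i, BoolFamily G H i →* Monoid.Coprod G H := fun i => match i with
    | false => (Monoid.Coprod.inl : G →* Monoid.Coprod G H)
    | true => (Monoid.Coprod.inr : H →* Monoid.Coprod G H)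
  have h : (Monoid.CoprodI.lift f).comp (coprodToCoprodI G H) = MonoidHom.id _ := by
    apply Monoid.Coprod.hom_ext <;> refine MonoidHom.ext fun x => ?_
    · exact Monoid.CoprodI.lift_of (i := false) f x
    · exact Monoid.CoprodI.lift_of (i := true) f x
  exact Function.LeftInverse.injective (g := Monoid.CoprodI.lift f) fun x => DFunLike.congr_fun h x

theorem FreeGroup.of_ne_inv_of {α : Type*} (x y : α) : FreeGroup.of x ≠ (FreeGroup.of y)⁻¹ := by
  intro h
  have := congrArg (FreeGroup.lift fun _ => Multiplicative.ofAdd (1 : ℤ)) h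
  rw [_root_.map_inv, FreeGroup.lift_apply_of, FreeGroup.lift_apply_of] at this
  revert this
  decide

@[simp] theorem constrPhi_yGen (X Y : Type) :
    constrPhi X Y (FreeGroup.of (yGen X Y)) = FreeGroup.of (yGen X Y) := by
  simp [constrPhi, yGen]

@[simp] theorem constrPhi_nGen (X Y : Type) (n : ℕ) :
    constrPhi X Y (FreeGroup.of (nGen X Y n)) =
      FreeGroup.of (yGen X Y) * (FreeGroup.of (nGen X Y (n + 1)))⁻¹ *
        FreeGroup.of (nGen X Y n) * FreeGroup.of (nGen X Y (n + 1)) := by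
  simp [constrPhi, nGen]

/-- `zₙ₊₁` is not the conjugate of `y⁻¹tₙ₊₁` by a power of `y⁻¹tₙ`. -/
theorem nGen_ne_zpow_conj (X Y : Type) (n : ℕ) (j : ℤ) :
    (FreeGroup.of (nGen X Y (n + 1)) : FreeGroup (ConstrGen X Y)) ≠
      constrPhi X Y (((FreeGroup.of (yGen X Y))⁻¹ * FreeGroup.of (nGen X Y n)) ^ j)⁻¹ *
        constrPhi X Y ((FreeGroup.of (yGen X Y))⁻¹ * FreeGroup.of (nGen X Y (n + 1))) *
        constrPhi X Y (((FreeGroup.of (yGen X Y))⁻¹ * FreeGroup.of (nGen X Y n)) ^ j) := by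
  classical
  intro h
  let f : FreeGroup (ConstrGen X Y) →* Equiv.Perm (Fin 3) := FreeGroup.lift fun g =>
    if g = nGen X Y (n + 1) then Equiv.swap 0 1
    else if g = nGen X Y (n + 2) then Equiv.swap 1 2 else 1
  have h₀ : f (FreeGroup.of (nGen X Y n)) = 1 := by simp [f, nGen]
  have h₁ : f (FreeGroup.of (nGen X Y (n + 1))) = Equiv.swap 0 1 := by simp [f]
  have h₂ : f (FreeGroup.of (nGen X Y (n + 1 + 1))) = Equiv.swap 1 2 := by simp [f, nGen]
  have := congrArg f h
  simp only [map_mul, map_inv, map_zpow, constrPhi_yGen, constrPhi_nGen, h₀, h₁, h₂] at this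
  simp [mul_assoc] at this
  revert this
  decide

/-- If `ψ : F_a → L_0 ∗ L_1` is an injective homomorphism with
`ψ(F_1) = ψ(F_a) ∩ L_0` and `ψ(F_0 ∨ F_{2,a}) = ψ(F_a) ∩ L_1`, then there is no
injective homomorphism `θ : F_b → L_0 ∗ L_1` with `θ ∘ φ = ψ`. -/
theorem no_injective_extension (X Y : Type) (L₀ L₁ : Type) [Group L₀] [Group L₁]
    (ψ : FreeGroup (ConstrGen X Y) →* Monoid.Coprod L₀ L₁)
    (hψ : Function.Injective ψ)
    (h1 : Subgroup.map ψ (F1sub X Y) =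
      ψ.range ⊓ (Monoid.Coprod.inl : L₀ →* Monoid.Coprod L₀ L₁).range)
    (h2 : Subgroup.map ψ (F02sub X Y) =
      ψ.range ⊓ (Monoid.Coprod.inr : L₁ →* Monoid.Coprod L₀ L₁).range) :
    ¬ ∃ θ : FreeGroup (ConstrGen X Y) →* Monoid.Coprod L₀ L₁,
        Function.Injective θ ∧ θ.comp (constrPhi X Y) = ψ := by
  classical
  rintro ⟨θ, hθ, hθψ⟩
  have hyF : FreeGroup.of (yGen X Y) ∈ F1sub X Y :=
    Subgroup.subset_closure ⟨_, by simp [yGen], rfl⟩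
  have htF (n : ℕ) : FreeGroup.of (nGen X Y n) ∈ F02sub X Y :=
    Subgroup.subset_closure ⟨_, by simp [nGen], rfl⟩
  obtain ⟨b, hb⟩ := (h1.le (Subgroup.mem_map_of_mem ψ hyF)).2
  have hc (n : ℕ) := (h2.le (Subgroup.mem_map_of_mem ψ (htF n))).2
  choose c hc using hc
  obtain ⟨Θ, hΘθ⟩ : ∃ Θ, Θ = (coprodToCoprodI L₀ L₁).comp θ := ⟨_, rfl⟩
  have hΘ : Function.Injective Θ := hΘθ ▸ (coprodToCoprodI_injective L₀ L₁).comp hθ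
  have hΨ : Function.Injective (Θ.comp (constrPhi X Y)) := by
    rw [hΘθ, MonoidHom.comp_assoc, hθψ]
    exact (coprodToCoprodI_injective L₀ L₁).comp hψ
  let B : BoolFamily L₀ L₁ false := b
  let C : ℕ → BoolFamily L₀ L₁ true := c
  have hB : Monoid.CoprodI.of B = Θ (constrPhi X Y (FreeGroup.of (yGen X Y))) := by
    subst hΘθ
    change _ = coprodToCoprodI L₀ L₁ ((θ.comp (constrPhi X Y)) _)
    rw [hθψ, ← hb]
    rfl
  have hC (n : ℕ) : Monoid.CoprodI.of (C n) = Θ (constrPhi X Y (FreeGroup.of (nGen X Y n))) := by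
    subst hΘθ
    change _ = coprodToCoprodI L₀ L₁ ((θ.comp (constrPhi X Y)) _)
    rw [hθψ, ← hc]
    rfl
  have hΨ₁ : ∀ x, x ≠ 1 → Θ (constrPhi X Y x) ≠ 1 := fun x => (map_ne_one_iff _ hΨ).2
  have hnGen : Function.Injective (nGen X Y) := fun m n h => by simpa [nGen] using h
  obtain ⟨n, j, h⟩ := Monoid.CoprodI.exists_zpow_conj_of_chain (b := B) (c := C)
    (fun h => hΨ₁ _ (FreeGroup.of_ne_one (yGen X Y)) (by rw [← hB, h, map_one]))
    (fun h => FreeGroup.of_ne_inv_of (yGen X Y) (yGen X Y) <| hΨ <| by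
      simp only [map_inv, MonoidHom.comp_apply, ← hB]
      rw [← map_inv, h])
    (fun n h => hΨ₁ _ (FreeGroup.of_ne_one (nGen X Y n)) (by rw [← hC, h, map_one]))
    (fun n h => n.succ_ne_self <| hnGen <| FreeGroup.of_injective <| hΨ <| by
      simp only [MonoidHom.comp_apply, Nat.succ_eq_add_one, ← hC, h])
    (fun n h => FreeGroup.of_ne_inv_of (nGen X Y (n + 1)) (nGen X Y n) <| hΨ <| by
      simp only [map_inv, MonoidHom.comp_apply, ← hC]
      rw [h, map_inv])
    (fun n => Θ (FreeGroup.of (nGen X Y n)))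
    (fun n => by
      rw [map_inv, hB, hC, constrPhi_yGen, constrPhi_nGen]
      simp [mul_assoc])
  refine nGen_ne_zpow_conj X Y n j (hΘ ?_)
  rw [h, map_inv, hB, hC, hC]
  simp only [map_mul, map_inv, map_zpow]
end
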